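/- Let M be an R-module projective in σ[M], semiprime, satisfying ACC on annihilators, such that every nonzero submodule of M contains a uniform submodule. If P_1, ..., P_n are the minimal primes in M and N_i = Ann_M^r(P_i), then N_1 ⊕ N_2 ⊕ ... ⊕ N_n is an essential submodule of M. -/

import Mathlib

/- Common definitions: the category σ[M], projectivity in σ[M], the product
   K_M L of submodules, annihilators, prime/semiprime submodules, hereditary
   torsion theories, M-singular modules, etc., following the paper. -/

universe u v

section Defs

variable (R : Type u) [Ring R]

/-- `N` belongs to `σ[M]`: `N` is isomorphic to a submodule of an `M`-generated
module, i.e. `N` embeds into a quotient of a direct sum of copies of `M`. -/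
def InSigma (M : Type v) [AddCommGroup M] [Module R M]
    (N : Type v) [AddCommGroup N] [Module R N] : Prop :=
  ∃ (ι : Type v) (K : Submodule R (ι →₀ M)) (g : N →ₗ[R] ((ι →₀ M) ⧸ K)),
    Function.Injective g

/-- `M` is projective in `σ[M]`. -/
def ProjInSigma (M : Type v) [AddCommGroup M] [Module R M] : Prop :=
  ∀ (A B : Type v) [AddCommGroup A] [Module R A] [AddCommGroup B] [Module R B],
    InSigma R M A → InSigma R M B →
      ∀ (p : A →ₗ[R] B), Function.Surjective p →
        ∀ f : M →ₗ[R] B, ∃ g : M →ₗ[R] A, p.comp g = f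

variable (M : Type v) [AddCommGroup M] [Module R M]

/-- The product `K_M L = Σ { f(K) : f ∈ Hom_R(M, L) }` of submodules of `M`. -/
def prodM (K L : Submodule R M) : Submodule R M :=
  ⨆ f ∈ {f : M →ₗ[R] M | LinearMap.range f ≤ L}, Submodule.map f K

/-- `Ann_M(X) = ∩ { ker f : f ∈ Hom_R(M, X) }`. -/
def annM (X : Type v) [AddCommGroup X] [Module R X] : Submodule R M :=
  ⨅ f : M →ₗ[R] X, LinearMap.ker f

/-- The right annihilator `Ann_M^r(N) = Σ { L ⊆ M : N_M L = 0 }`. -/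
def annMr (N : Submodule R M) : Submodule R M :=
  sSup {L : Submodule R M | prodM R M N L = ⊥}

/-- A submodule is fully invariant if it is stable under all endomorphisms. -/
def IsFullyInvariant (N : Submodule R M) : Prop :=
  ∀ f : M →ₗ[R] M, Submodule.map f N ≤ N

/-- `M` is a semiprime module: `K_M K = 0` implies `K = 0`. -/
def IsSemiprime : Prop :=
  ∀ K : Submodule R M, prodM R M K K = ⊥ → K = ⊥

/-- `P` is prime in `M`. -/
def PrimeIn (P : Submodule R M) : Prop :=
  P ≠ ⊤ ∧ IsFullyInvariant R M P ∧
    ∀ K L : Submodule R M, IsFullyInvariant R M K → IsFullyInvariant R M L →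
      prodM R M K L ≤ P → K ≤ P ∨ L ≤ P

/-- `P` is a minimal prime in `M`. -/
def MinPrimeIn (P : Submodule R M) : Prop :=
  PrimeIn R M P ∧ ∀ Q : Submodule R M, PrimeIn R M Q → Q ≤ P → Q = P

/-- Powers of a submodule: `powM N k = N^(k+1)`, i.e. `powM N 0 = N` and
`powM N (k+1) = N_M (powM N k)`. -/
def powM (N : Submodule R M) : ℕ → Submodule R M
  | 0 => N
  | k + 1 => prodM R M N (powM N k)

/-- The set of annihilator submodules `∩_{f ∈ X} ker f` for `X ⊆ End_R(M)`. -/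
def AnnSet : Set (Submodule R M) :=
  {N | ∃ X : Set (M →ₗ[R] M), N = ⨅ f ∈ X, LinearMap.ker f}

/-- `M` satisfies ACC on annihilators. -/
def AccOnAnnihilators : Prop :=
  ∀ c : ℕ → Submodule R M, (∀ n, c n ∈ AnnSet R M) → Monotone c →
    ∃ n, ∀ m, n ≤ m → c m = c n

/-- `U` is a uniform submodule of `M`. -/
def UniformSub (U : Submodule R M) : Prop :=
  U ≠ ⊥ ∧ ∀ A B : Submodule R M, A ≤ U → B ≤ U → A ≠ ⊥ → B ≠ ⊥ → A ⊓ B ≠ ⊥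

end Defs

section Torsion

variable (R : Type u) [Ring R]

/-- A hereditary torsion theory, presented via its torsion class: a class of
modules closed under submodules, quotients, extensions, isomorphisms and
direct sums. -/
structure HTC : Type (max u (v + 1)) where
  torsion : ∀ (N : Type v) [AddCommGroup N] [Module R N], Prop
  closed_sub : ∀ (N : Type v) [AddCommGroup N] [Module R N],
    torsion N → ∀ K : Submodule R N, torsion K
  closed_quot : ∀ (N : Type v) [AddCommGroup N] [Module R N],
    torsion N → ∀ K : Submodule R N, torsion (N ⧸ K)
  closed_ext : ∀ (N : Type v) [AddCommGroup N] [Module R N] (K : Submodule R N),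
    torsion K → torsion (N ⧸ K) → torsion N
  closed_iso : ∀ (N N' : Type v) [AddCommGroup N] [Module R N]
    [AddCommGroup N'] [Module R N'], (N ≃ₗ[R] N') → torsion N → torsion N'
  closed_dsum : ∀ (ι : Type v) (F : ι → Type v) [DecidableEq ι]
    [∀ i, AddCommGroup (F i)] [∀ i, Module R (F i)],
    (∀ i, torsion (F i)) → torsion (DirectSum ι F)

/-- `N` is `τ`-torsion-free. -/
def TorsionFreeFor (τ : HTC.{u, v} R) (N : Type v) [AddCommGroup N] [Module R N] : Prop :=
  ∀ K : Submodule R N, τ.torsion ↥K → K = ⊥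

variable (M : Type v) [AddCommGroup M] [Module R M]

/-- `N` is `χ(M)`-torsion: torsion for some (hence for the greatest) hereditary
torsion theory for which `M` is torsion-free. -/
def ChiTorsion (N : Type v) [AddCommGroup N] [Module R N] : Prop :=
  ∃ τ : HTC.{u, v} R, TorsionFreeFor R τ M ∧ τ.torsion N

/-- `N` is `χ(M)`-torsion-free. -/
def ChiTorsionFree (N : Type v) [AddCommGroup N] [Module R N] : Prop :=
  ∀ K : Submodule R N, ChiTorsion R M ↥K → K = ⊥

/-- `X` is `M`-singular: `X ≅ L/K` with `L ∈ σ[M]` and `K` essential in `L`. -/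
def IsMSingular (X : Type v) [AddCommGroup X] [Module R X] : Prop :=
  ∃ (L : Type v) (iL : AddCommGroup L)
    (mL : @Module R L inferInstance iL.toAddCommMonoid),
    letI := iL
    letI := mL
    InSigma R M L ∧ ∃ K : Submodule R L,
      (∀ K' : Submodule R L, K' ≠ ⊥ → K ⊓ K' ≠ ⊥) ∧ Nonempty (X ≃ₗ[R] (L ⧸ K))

/-- The `M`-singular submodule `Z(M)` of `M`. -/
def singularSub : Submodule R M :=
  sSup {K : Submodule R M | IsMSingular R M ↥K}

/-- `Ass_M(X)`: the set of primes in `M` associated to `X`. -/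
def AssM (X : Type v) [AddCommGroup X] [Module R X] : Set (Submodule R M) :=
  {P | P ≠ ⊤ ∧ IsFullyInvariant R M P ∧
    ∃ L : Submodule R X, L ≠ ⊥ ∧
      ∀ L' : Submodule R X, L' ≠ ⊥ → L' ≤ L → annM R M ↥L' = P}

/-- `E` is an injective object of `σ[M]`. -/
def InjInSigma (E : Type v) [AddCommGroup E] [Module R E] : Prop :=
  InSigma R M E ∧
    ∀ (B : Type v) [AddCommGroup B] [Module R B], InSigma R M B →
      ∀ (A : Submodule R B) (f : ↥A →ₗ[R] E),
        ∃ g : B →ₗ[R] E, ∀ a : A, g ↑a = f a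

/-- `E` is an indecomposable module. -/
def Indecomp (E : Type v) [AddCommGroup E] [Module R E] : Prop :=
  (⊥ : Submodule R E) ≠ ⊤ ∧
    ∀ A B : Submodule R E, IsCompl A B → A = ⊥ ∨ A = ⊤

/-- `M` has finite uniform dimension: there is no infinite independent family
of nonzero submodules. -/
def FiniteUniformDimension : Prop :=
  ¬ ∃ f : ℕ → Submodule R M, (∀ n, f n ≠ ⊥) ∧
      ∀ n : ℕ, f n ⊓ (⨆ m ∈ {m : ℕ | m ≠ n}, f m) = ⊥

/-- `M` is a continuous module (conditions C1 and C2). -/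
def ContinuousModule : Prop :=
  (∀ N : Submodule R M, ∃ D : Submodule R M, (∃ D', IsCompl D D') ∧ N ≤ D ∧
      ∀ L : Submodule R M, L ≤ D → L ≠ ⊥ → N ⊓ L ≠ ⊥) ∧
  (∀ N D : Submodule R M, (∃ D', IsCompl D D') → Nonempty (↥N ≃ₗ[R] ↥D) →
      ∃ N', IsCompl N N')

end Torsion

section Helpers

variable {R : Type u} [Ring R] {M : Type v} [AddCommGroup M] [Module R M]

lemma inSigma_of_injective {N : Type v} [AddCommGroup N] [Module R N] {ι : Type v}
    (g : N →ₗ[R] (ι →₀ M)) (hg : Function.Injective g) : InSigma R M N := by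
  refine ⟨ι, ⊥, (Submodule.mkQ ⊥).comp g, ?_⟩
  rw [LinearMap.coe_comp]
  refine Function.Injective.comp ?_ hg
  rw [← LinearMap.ker_eq_bot, Submodule.ker_mkQ]

/-- An endomorphism with values in `∑ i, h i (L)` factors through `⊕ i, L`, so it vanishes at
every point that all the maps `M → L → h i (L)` kill. -/
lemma ProjInSigma.apply_eq_zero (hproj : ProjInSigma R M) {ι : Type v}
    (h : ι → M →ₗ[R] M) (L : Submodule R M) (f : M →ₗ[R] M)
    (hf : LinearMap.range f ≤ ⨆ i, L.map (h i)) (x : M)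
    (hx : ∀ i, ∀ g : M →ₗ[R] M, LinearMap.range g ≤ L → h i (g x) = 0) : f x = 0 := by
  let p : (ι →₀ L) →ₗ[R] M := Finsupp.lsum ℕ fun i => (h i).comp L.subtype
  have hp : ⨆ i, L.map (h i) ≤ LinearMap.range p := by
    refine iSup_le fun i => ?_
    rintro _ ⟨y, hy, rfl⟩
    exact ⟨Finsupp.single i ⟨y, hy⟩, by simp [p]⟩
  have hA : InSigma R M (ι →₀ L) :=
    inSigma_of_injective (Finsupp.mapRange.linearMap L.subtype)
      (Finsupp.mapRange_injective _ (map_zero _) L.injective_subtype)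
  have hB : InSigma R M (LinearMap.range p) :=
    inSigma_of_injective
      ((Finsupp.lsingle (PUnit.unit : PUnit.{v + 1})).comp (LinearMap.range p).subtype)
      ((Finsupp.single_injective _).comp (Submodule.injective_subtype _))
  obtain ⟨g, hg⟩ := hproj _ _ hA hB p.rangeRestrict p.surjective_rangeRestrict
    (f.codRestrict _ fun y => hp (hf ⟨y, rfl⟩))
  have hgx : p (g x) = f x := congrArg Subtype.val (LinearMap.congr_fun hg x)
  rw [← hgx, Finsupp.lsum_apply]
  refine Finset.sum_eq_zero fun i _ => ?_
  refine hx i (L.subtype.comp ((Finsupp.lapply i).comp g)) ?_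
  rintro _ ⟨y, rfl⟩
  exact (g y i).2

variable (R M) in
/-- The annihilator `Ann_M(L)` of a submodule `L` of `M`, written inside `End_R(M)`. -/
def annSub (L : Submodule R M) : Submodule R M :=
  ⨅ f ∈ {f : M →ₗ[R] M | LinearMap.range f ≤ L}, LinearMap.ker f

lemma mem_annSub {L : Submodule R M} {x : M} :
    x ∈ annSub R M L ↔ ∀ f : M →ₗ[R] M, LinearMap.range f ≤ L → f x = 0 := by
  simp [annSub]

lemma annSub_antitone : Antitone (annSub R M) := fun _ _ h _ hx =>
  mem_annSub.2 fun f hf => mem_annSub.1 hx f (hf.trans h)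

lemma prodM_le_iff {K L N : Submodule R M} :
    prodM R M K L ≤ N ↔
      ∀ f : M →ₗ[R] M, LinearMap.range f ≤ L → ∀ x ∈ K, f x ∈ N := by
  simp only [prodM, iSup_le_iff, Set.mem_ofPred_eq, Submodule.map_le_iff_le_comap]
  rfl

lemma prodM_eq_bot_iff {K L : Submodule R M} :
    prodM R M K L = ⊥ ↔ K ≤ annSub R M L := by
  rw [← le_bot_iff, prodM_le_iff]
  simp only [Submodule.mem_bot, SetLike.le_def, mem_annSub]
  exact ⟨fun h x hx f hf => h f hf x hx, fun h f hf x hx => h hx f hf⟩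

lemma isFullyInvariant_annSub (L : Submodule R M) :
    IsFullyInvariant R M (annSub R M L) := by
  rintro g _ ⟨x, hx, rfl⟩
  exact mem_annSub.2 fun f hf =>
    mem_annSub.1 hx (f.comp g) ((LinearMap.range_comp_le_range g f).trans hf)

lemma not_le_annSub (hsemi : IsSemiprime R M) {L : Submodule R M} (hL : L ≠ ⊥) :
    ¬ L ≤ annSub R M L := fun h => hL (hsemi L (prodM_eq_bot_iff.2 h))

/-- `Ann_M(L)` is prime when it equals the annihilator of every nonzero submodule of `L`. -/
lemma primeIn_annSub (hproj : ProjInSigma R M) (hsemi : IsSemiprime R M)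
    {L : Submodule R M} (hL : L ≠ ⊥)
    (hmax : ∀ L' ≤ L, L' ≠ ⊥ → annSub R M L' ≤ annSub R M L) :
    PrimeIn R M (annSub R M L) := by
  refine ⟨fun h => not_le_annSub hsemi hL (h ▸ le_top), isFullyInvariant_annSub L,
    fun K H _ _ hKH => ?_⟩
  by_contra! hcon
  obtain ⟨hK, hH⟩ := hcon
  obtain ⟨y, hyH, hy⟩ := SetLike.not_le_iff_exists.1 hH
  simp only [mem_annSub, not_forall] at hy
  obtain ⟨f, hf, hfy⟩ := hy
  refine hK (le_trans (fun x hx => ?_) (hmax (H.map f) (LinearMap.map_le_range.trans hf) ?_))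
  · refine mem_annSub.2 fun g hg => ?_
    refine hproj.apply_eq_zero (fun _ : PUnit.{v + 1} => f) H g (by simpa using hg) x
      fun _ g' hg' => ?_
    exact mem_annSub.1 (prodM_le_iff.1 hKH g' hg' x hx) f hf
  · intro h
    have hmem : f y ∈ H.map f := ⟨y, hyH, rfl⟩
    rw [h] at hmem
    exact hfy (by simpa using hmem)

lemma minPrimeIn_annSub (hproj : ProjInSigma R M) (hsemi : IsSemiprime R M)
    {L : Submodule R M} (hL : L ≠ ⊥)
    (hmax : ∀ L' ≤ L, L' ≠ ⊥ → annSub R M L' ≤ annSub R M L) :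
    MinPrimeIn R M (annSub R M L) := by
  refine ⟨primeIn_annSub hproj hsemi hL hmax, fun Q hQ hle => hle.antisymm ?_⟩
  have hinv : IsFullyInvariant R M (⨆ h : M →ₗ[R] M, L.map h) := by
    intro g
    rw [Submodule.map_iSup]
    refine iSup_le fun h => ?_
    rw [← Submodule.map_comp]
    exact le_iSup (fun h : M →ₗ[R] M => L.map h) (g.comp h)
  have hprod : prodM R M (annSub R M L) (⨆ h : M →ₗ[R] M, L.map h) ≤ Q := by
    refine prodM_le_iff.2 fun f hf x hx => ?_
    rw [hproj.apply_eq_zero (fun h : M →ₗ[R] M => h) L f hf x fun i g hg => by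
      rw [mem_annSub.1 hx g hg, map_zero]]
    exact Q.zero_mem
  refine (hQ.2.2 _ _ (isFullyInvariant_annSub L) hinv hprod).resolve_right fun h => ?_
  refine not_le_annSub hsemi hL (le_trans ?_ (h.trans hle))
  simpa using le_iSup (fun h : M →ₗ[R] M => L.map h) LinearMap.id

lemma exists_annSub_maximal (hacc : AccOnAnnihilators R M) {L : Submodule R M} (hL : L ≠ ⊥) :
    ∃ L₀ ≤ L, L₀ ≠ ⊥ ∧ ∀ L' ≤ L₀, L' ≠ ⊥ → annSub R M L' ≤ annSub R M L₀ := by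
  have hwf : WellFoundedGT (AnnSet R M) := by
    rw [wellFoundedGT_iff_monotone_chain_condition]
    intro c
    obtain ⟨n, hn⟩ := hacc (fun k => c k) (fun k => (c k).2) fun _ _ h => c.monotone h
    exact ⟨n, fun m hm => Subtype.ext (hn m hm).symm⟩
  let a : Submodule R M → AnnSet R M := fun L' => ⟨annSub R M L', _, rfl⟩
  obtain ⟨L₀, ⟨hle, hne⟩, hmax⟩ := (InvImage.wf a hwf.wf).has_min
    {L' | L' ≤ L ∧ L' ≠ ⊥} ⟨L, le_rfl, hL⟩
  refine ⟨L₀, hle, hne, fun L' hL' hne' => ?_⟩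
  by_contra hcon
  exact hmax L' ⟨hL'.trans hle, hne'⟩ (lt_of_le_not_ge (annSub_antitone hL') hcon)

end Helpers

/-- Theorem 2.18: `N_1 ⊕ ⋯ ⊕ N_n` with `N_i = Ann_M^r(P_i)` is
essential in `M`. -/
theorem stmt_16 (R : Type u) [Ring R] (M : Type v) [AddCommGroup M] [Module R M]
    (hproj : ProjInSigma R M) (hsemi : IsSemiprime R M)
    (hacc : AccOnAnnihilators R M)
    (hunif : ∀ N : Submodule R M, N ≠ ⊥ → ∃ U : Submodule R M,
      U ≤ N ∧ UniformSub R M U)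
    (n : ℕ) (P : Fin n → Submodule R M) (hinj : Function.Injective P)
    (hmin : ∀ i, MinPrimeIn R M (P i))
    (hall : ∀ Q : Submodule R M, MinPrimeIn R M Q → ∃ i, Q = P i) :
    ∀ L : Submodule R M, L ≠ ⊥ →
      (⨆ i : Fin n, annMr R M (P i)) ⊓ L ≠ ⊥ := by
  intro L hL hbot
  obtain ⟨L₀, hle, hne, hmax⟩ := exists_annSub_maximal hacc hL
  obtain ⟨i, hi⟩ := hall _ (minPrimeIn_annSub hproj hsemi hne hmax)
  have hmem : L₀ ≤ annMr R M (P i) := le_sSup (prodM_eq_bot_iff.2 hi.ge)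
  exact hne (le_bot_iff.1 (hbot ▸ le_inf (hmem.trans (le_iSup (fun i => annMr R M (P i)) i)) hle))
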